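/- Let N = 11 and let τ = (−11 + √−11)/22 ∈ ℍ (real part −1/2 and imaginary part √11/22), the Heegner point of discriminant −11, which corresponds to the rational point (5, −6) on Yang's model of X₀(11) and to an elliptic curve admitting an endomorphism of degree 11 defined over ℚ. Then E₂^{(11)}(τ) ≠ 0, a₄(τ) = −33/2, and a₆(τ) = −847/32; moreover a₄′(τ) = −3/22 and a₆′(τ) = 7/352. -/

import Mathlib

open Complex UpperHalfPlane Matrix MatrixGroups Filter

/-- `q = e^{2πiτ}`. -/
noncomputable def qExp (τ : ℂ) : ℂ := Complex.exp (2 * Real.pi * Complex.I * τ)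

/-- `σ_k(n) = Σ_{d ∣ n} d^k`. -/
def sigma' (k n : ℕ) : ℕ := ∑ d ∈ n.divisors, d ^ k

/-- Normalized Eisenstein series `E₄(τ) = 1 + 240 Σ_{n≥1} σ₃(n) qⁿ`. -/
noncomputable def E4 (τ : ℂ) : ℂ := 1 + 240 * ∑' n : ℕ+, (sigma' 3 n : ℂ) * qExp τ ^ (n : ℕ)

/-- Normalized Eisenstein series `E₆(τ) = 1 − 504 Σ_{n≥1} σ₅(n) qⁿ`. -/
noncomputable def E6 (τ : ℂ) : ℂ := 1 - 504 * ∑' n : ℕ+, (sigma' 5 n : ℂ) * qExp τ ^ (n : ℕ)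

/-- Normalized weight-2 Eisenstein series `E₂(τ) = 1 − 24 Σ_{n≥1} σ₁(n) qⁿ`. -/
noncomputable def E2 (τ : ℂ) : ℂ := 1 - 24 * ∑' n : ℕ+, (sigma' 1 n : ℂ) * qExp τ ^ (n : ℕ)

/-- `E₂^{(N)}(τ) = (N−1)/24 + Σ_{n≥1} σ₁(n)(qⁿ − N q^{Nn})`. -/
noncomputable def E2N (N : ℕ) (τ : ℂ) : ℂ :=
  ((N : ℂ) - 1) / 24 +
    ∑' n : ℕ+, (sigma' 1 n : ℂ) * (qExp τ ^ (n : ℕ) - (N : ℂ) * qExp τ ^ (N * (n : ℕ)))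

/-- `a₄(τ) = −E₄(τ)/(48 E₂^{(N)}(τ)²)`. -/
noncomputable def a4 (N : ℕ) (τ : ℂ) : ℂ := -E4 τ / (48 * E2N N τ ^ 2)

/-- `a₆(τ) = E₆(τ)/(864 E₂^{(N)}(τ)³)`. -/
noncomputable def a6 (N : ℕ) (τ : ℂ) : ℂ := E6 τ / (864 * E2N N τ ^ 3)

/-- `a₄′(τ) = −E₄(Nτ)/(48 E₂^{(N)}(τ)²)`. -/
noncomputable def a4' (N : ℕ) (τ : ℂ) : ℂ := -E4 ((N : ℂ) * τ) / (48 * E2N N τ ^ 2)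

/-- `a₆′(τ) = E₆(Nτ)/(864 E₂^{(N)}(τ)³)`. -/
noncomputable def a6' (N : ℕ) (τ : ℂ) : ℂ := E6 ((N : ℂ) * τ) / (864 * E2N N τ ^ 3)

lemma E4_coe (z : ℍ) : E4 z = ModularForm.E₄ z := by
  rw [EisensteinSeries.q_expansion_bernoulli (by norm_num) ⟨2, rfl⟩ z]
  have hb : bernoulli 4 = -1/30 := by simp [bernoulli_eq_bernoulli'_of_ne_one]
  simp only [E4, hb, qExp, sigma', ArithmeticFunction.sigma_apply, zpow_natCast]
  push_cast
  norm_num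
  try ring

lemma E6_coe (z : ℍ) : E6 z = ModularForm.E₆ z := by
  rw [EisensteinSeries.q_expansion_bernoulli (by norm_num) ⟨3, rfl⟩ z]
  have hb : bernoulli 6 = 1/42 := by
    rw [bernoulli_eq_bernoulli'_of_ne_one (by norm_num), bernoulli'_def]
    have h5 : bernoulli' 5 = 0 := by
      rw [bernoulli'_def]; simp [Finset.sum_range_succ]; norm_num [Nat.choose]
    simp [Finset.sum_range_succ, h5]; norm_num [Nat.choose]
  simp only [E6, hb, qExp, sigma', ArithmeticFunction.sigma_apply, zpow_natCast]
  push_cast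
  norm_num
  try ring

lemma E2_coe (z : ℍ) : E2 z = EisensteinSeries.E2 z := by
  rw [EisensteinSeries.E2_eq_tsum_cexp]
  simp only [E2, qExp, sigma', ArithmeticFunction.sigma_apply]

lemma qExp_add_one (z : ℂ) : qExp (z + 1) = qExp z := by
  unfold qExp
  rw [mul_add, mul_one, Complex.exp_periodic]

lemma E4_add_one (z : ℂ) : E4 (z + 1) = E4 z := by simp only [E4, qExp_add_one]
lemma E6_add_one (z : ℂ) : E6 (z + 1) = E6 z := by simp only [E6, qExp_add_one]
lemma E2_add_one (z : ℂ) : E2 (z + 1) = E2 z := by simp only [E2, qExp_add_one]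

lemma im_neg_inv {z : ℂ} (hz : 0 < z.im) : 0 < (-1 / z).im := by
  have : (-1 / z).im = z.im / Complex.normSq z := by
    simp [Complex.div_im, neg_div]
  rw [this]
  have : z ≠ 0 := by rintro rfl; simp at hz
  have := Complex.normSq_pos.mpr this
  positivity

open scoped ModularForm in
lemma modS {k : ℤ} (f : ModularForm 𝒮ℒ k) (z : ℍ) :
    ((f : ℍ → ℂ) ∣[k] ModularGroup.S) z = f z :=
  congr_fun (SlashInvariantForm.slash_action_eqn f ModularGroup.S ⟨_, rfl⟩) z

lemma E4_S {z : ℂ} (hz : 0 < z.im) : E4 (-1 / z) = z ^ 4 * E4 z := by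
  have h0 : z ≠ 0 := by rintro rfl; simp at hz
  have h := modS ModularForm.E₄ ⟨z, hz⟩
  rw [SlashInvariantForm.slash_S_apply, ← E4_coe, ← E4_coe] at h
  simp only at h
  rw [← h]
  rw [mul_comm, mul_assoc, show (z:ℂ)^(-4:ℤ) = (z^4)⁻¹ from by rw [_root_.zpow_neg]; rfl, inv_mul_cancel₀ (pow_ne_zero _ h0), mul_one]
  congr 1
  field_simp

lemma E6_S {z : ℂ} (hz : 0 < z.im) : E6 (-1 / z) = z ^ 6 * E6 z := by
  have h0 : z ≠ 0 := by rintro rfl; simp at hz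
  have h := modS ModularForm.E₆ ⟨z, hz⟩
  rw [SlashInvariantForm.slash_S_apply, ← E6_coe, ← E6_coe] at h
  simp only at h
  rw [← h]
  rw [mul_comm, mul_assoc, show (z:ℂ)^(-6:ℤ) = (z^6)⁻¹ from by rw [_root_.zpow_neg]; rfl, inv_mul_cancel₀ (pow_ne_zero _ h0), mul_one]
  congr 1
  field_simp

lemma E2_S {z : ℂ} (hz : 0 < z.im) : E2 (-1 / z) = z ^ 2 * E2 z + 6 / (Real.pi * Complex.I) * z := by
  have h0 : z ≠ 0 := by rintro rfl; simp at hz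
  have h := congr_fun (EisensteinSeries.E2_slash_action ModularGroup.S) ⟨z, hz⟩
  rw [SlashInvariantForm.slash_S_apply, Pi.sub_apply, Pi.smul_apply, ← E2_coe, ← E2_coe,
    EisensteinSeries.D2_S, riemannZeta_two] at h
  simp only at h
  have h1 : E2 (-1 / z) = z ^ 2 * (E2 (-z)⁻¹ * z ^ (-2:ℤ)) := by
    rw [mul_comm, mul_assoc, show (z:ℂ)^(-2:ℤ) = (z^2)⁻¹ from by rw [_root_.zpow_neg]; rfl, inv_mul_cancel₀ (pow_ne_zero _ h0), mul_one]
    congr 1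
    field_simp
  rw [h1, h]
  have hp : (Real.pi : ℂ) ≠ 0 := by exact_mod_cast Real.pi_ne_zero
  have hI : Complex.I^2 = -1 := Complex.I_sq
  have hI0 : Complex.I ≠ 0 := Complex.I_ne_zero
  simp only [smul_eq_mul]
  field_simp
  linear_combination (-6:ℂ) * hI

lemma diff_aux {f : ℂ → ℂ} {g : ℍ → ℂ} (h : ∀ z : ℍ, f z = g z)
    (hg : MDifferentiable (modelWithCornersSelf ℂ ℂ) (modelWithCornersSelf ℂ ℂ) g) :
    DifferentiableOn ℂ f {z | 0 < z.im} := by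
  rw [UpperHalfPlane.mdifferentiable_iff] at hg
  refine hg.congr fun z hz => ?_
  rw [Function.comp_apply, ofComplex_apply_of_im_pos hz, ← h]

lemma E4_diff : DifferentiableOn ℂ E4 {z | 0 < z.im} := diff_aux E4_coe (ModularForm.E₄).holo'
lemma E6_diff : DifferentiableOn ℂ E6 {z | 0 < z.im} := diff_aux E6_coe (ModularForm.E₆).holo'
lemma E2_diff : DifferentiableOn ℂ E2 {z | 0 < z.im} :=
  diff_aux E2_coe E2_mdifferentiable

lemma disc_ne {z : ℂ} (hz : 0 < z.im) (h4 : E4 z = 0) (h6 : E6 z = 0) : False := by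
  have h := ModularForm.discriminant_eq_E₄_cube_sub_E₆_sq ⟨z, hz⟩
  rw [← E4_coe, ← E6_coe] at h
  simp only [h4, h6] at h
  exact ModularForm.discriminant_ne_zero _ (by rw [h]; simp)

lemma sum_aux (c : ℂ) (k : ℕ) {z : ℂ} (hz : 0 < z.im) :
    HasSum (fun n : ℕ => (if n = 0 then 1 else c * (sigma' k n : ℂ)) * qExp z ^ n)
      (1 + c * ∑' n : ℕ+, (sigma' k n : ℂ) * qExp z ^ (n : ℕ)) := by
  have hS : Summable fun n : ℕ ↦ (sigma' k (n + 1) : ℂ) * qExp z ^ (n + 1) := by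
    have := (summable_nat_add_iff 1).mpr
      (EisensteinSeries.summable_sigma_mul_cexp_pow (k := k + 1) (by omega) ⟨z, hz⟩)
    simpa [sigma', ArithmeticFunction.sigma_apply, qExp] using this
  rw [← hasSum_nat_add_iff' 1]
  convert! (hS.mul_left c).hasSum using 1
  · ext n; simp [mul_assoc]
  · rw [tsum_pnat_eq_tsum_succ (f := fun n ↦ (sigma' k n : ℂ) * qExp z ^ n), tsum_mul_left]
    simp

lemma summable_aux (k : ℕ) {z : ℂ} (hz : 0 < z.im) :
    Summable fun n : ℕ+ ↦ (sigma' k n : ℂ) * qExp z ^ (n : ℕ) := by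
  have := (EisensteinSeries.summable_sigma_mul_cexp_pow (k := k + 1) (by omega) ⟨z, hz⟩)
  have h2 : Summable fun n : ℕ ↦ (sigma' k n : ℂ) * qExp z ^ n := by
    simpa [sigma', ArithmeticFunction.sigma_apply, qExp] using this
  exact h2.comp_injective PNat.coe_injective

lemma qExp_mul (n : ℕ) (z : ℂ) : qExp (n * z) = qExp z ^ n := by
  unfold qExp
  rw [← Complex.exp_nat_mul]; congr 1; ring

lemma E2N_eq {z : ℂ} (hz : 0 < z.im) : E2N 11 z = (11 * E2 (11 * z) - E2 z) / 24 := by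
  have h1 := summable_aux 1 hz
  have hz' : 0 < ((11 : ℂ) * z).im := by simpa using hz
  have h2 := summable_aux 1 hz'
  have e : ∀ n : ℕ, qExp z ^ (11 * n) = qExp (11 * z) ^ n := by
    intro n; rw [pow_mul, ← qExp_mul]; norm_num
  unfold E2N E2
  have : ∑' n : ℕ+, (sigma' 1 n : ℂ) * (qExp z ^ (n : ℕ) - ((11:ℕ) : ℂ) * qExp z ^ (11 * (n : ℕ)))
    = ∑' n : ℕ+, (sigma' 1 n : ℂ) * qExp z ^ (n : ℕ) - 11 * ∑' n : ℕ+, (sigma' 1 n : ℂ) * qExp (11 * z) ^ (n : ℕ) := by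
    rw [← tsum_mul_left, ← h1.tsum_sub (h2.mul_left 11)]
    congr 1; ext n; rw [e]; push_cast; ring
  rw [this]; push_cast; ring

/-- The filter of neighbourhoods of `i∞` on `ℂ`. -/
def LInf : Filter ℂ := Filter.comap Complex.im Filter.atTop

lemma tendsto_coe_LInf : Tendsto (fun z : ℍ => (z : ℂ)) atImInfty LInf := by
  unfold LInf atImInfty
  rw [tendsto_comap_iff]
  exact tendsto_comap

lemma tendsto_mul_LInf {r : ℝ} (hr : 0 < r) : Tendsto (fun z : ℂ => (r : ℂ) * z) LInf LInf := by
  unfold LInf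
  rw [tendsto_comap_iff]
  have : (Complex.im ∘ fun z : ℂ => (r : ℂ) * z) = fun z => r * z.im := by
    ext z; simp
  rw [this]
  exact (tendsto_comap).const_mul_atTop hr

lemma tendsto_add_LInf (r : ℝ) : Tendsto (fun z : ℂ => z + (r : ℂ)) LInf LInf := by
  unfold LInf
  rw [tendsto_comap_iff]
  have : (Complex.im ∘ fun z : ℂ => z + (r : ℂ)) = fun z => z.im := by
    ext z; simp
  rw [this]
  exact tendsto_comap

lemma eventually_LInf (r : ℝ) : ∀ᶠ z in LInf, r ≤ z.im :=
  tendsto_comap.eventually (eventually_ge_atTop r)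

lemma norm_qExp (z : ℂ) : ‖qExp z‖ = Real.exp (-2 * Real.pi * z.im) := by
  simp [qExp, Complex.norm_exp]

lemma qExp_ne (z : ℂ) : qExp z ≠ 0 := Complex.exp_ne_zero _

lemma qExp_bdd : qExp =O[LInf] (1 : ℂ → ℝ) := by
  refine .of_bound 1 ?_
  filter_upwards [eventually_LInf 0] with z hz
  rw [norm_qExp]
  simp
  positivity

lemma coeff_bdd (a : ℕ → ℂ) (f : ℂ → ℂ)
    (h : ∀ z : ℂ, 0 < z.im → HasSum (fun n => a n * qExp z ^ n) (f z)) (N : ℕ) :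
    (fun z => (f z - ∑ n ∈ Finset.range N, a n * qExp z ^ n) / qExp z ^ N)
      =O[LInf] (1 : ℂ → ℝ) := by
  have hs : ∀ z : ℂ, 0 < z.im → HasSum (fun n => a (n + N) * qExp z ^ n)
      ((f z - ∑ n ∈ Finset.range N, a n * qExp z ^ n) / qExp z ^ N) := by
    intro z hz
    have := ((hasSum_nat_add_iff' N).mpr (h z hz)).div_const (qExp z ^ N)
    refine this.congr_fun ?_ |> fun h => h
    intro n
    have := qExp_ne z
    field_simp
    try ring
  have hI := (hs Complex.I (by simp)).summable.norm
  refine .of_bound (∑' n, ‖a (n + N) * qExp Complex.I ^ n‖) ?_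
  filter_upwards [eventually_LInf 1] with z hz
  rw [← (hs z (by linarith)).tsum_eq]
  simp only [Pi.one_apply, norm_one, mul_one]
  have hle : ∀ n, ‖a (n + N) * qExp z ^ n‖ ≤ ‖a (n + N) * qExp Complex.I ^ n‖ := by
    intro n
    rw [norm_mul, norm_mul, norm_pow, norm_pow, norm_qExp, norm_qExp]
    have : Real.exp (-2 * Real.pi * z.im) ≤ Real.exp (-2 * Real.pi * Complex.I.im) := by
      apply Real.exp_le_exp.mpr
      rw [Complex.I_im]
      nlinarith [Real.pi_pos]
    gcongr
  have hz' := Summable.of_nonneg_of_le (fun n => norm_nonneg _) hle hI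
  exact (norm_tsum_le_tsum_norm hz').trans (hz'.tsum_le_tsum hle hI)

open scoped ModularForm in
lemma slash_T_aux (f : ℍ → ℂ) (k : ℤ) (z : ℍ) :
    (f ∣[k] ModularGroup.T) z = f ((1 : ℝ) +ᵥ z) := by
  rw [ModularForm.SL_slash_apply, UpperHalfPlane.modular_T_smul]
  have : UpperHalfPlane.denom (ModularGroup.T : GL (Fin 2) ℝ) z = 1 := by
    rw [ModularGroup.denom_apply]
    simp [ModularGroup.T]
  rw [this]; simp

open scoped ModularForm in
/-- A level one form of weight `k < 12 m` vanishing to order `m` at infinity vanishes. -/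
lemma levelOne_vanish {k m : ℕ} (P : ℂ → ℂ) (hP : DifferentiableOn ℂ P {z | 0 < z.im})
    (hT : ∀ z : ℂ, 0 < z.im → P (z + 1) = P z)
    (hS : ∀ z : ℂ, 0 < z.im → P (-1 / z) = z ^ k * P z)
    (hO : P =O[LInf] fun z => qExp z ^ m) (hkm : k < 12 * m) (z : ℂ) (hz : 0 < z.im) :
    P z = 0 := by
  set Q : ℍ → ℂ := fun z => P z / ModularForm.discriminant z ^ m with hQ
  have dT : ∀ z : ℍ, ModularForm.discriminant ((1 : ℝ) +ᵥ z) = ModularForm.discriminant z := by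
    intro z
    have := congr_fun ModularForm.discriminant_T_invariant z
    rwa [slash_T_aux] at this
  have dS : ∀ z : ℍ, ModularForm.discriminant (ModularGroup.S • z) = (z:ℂ)^12 * ModularForm.discriminant z := by
    intro z
    have := congr_fun ModularForm.discriminant_S_invariant z
    rw [SlashInvariantForm.slash_S_apply] at this
    rw [UpperHalfPlane.modular_S_smul, ← this, mul_comm, mul_assoc, show (z:ℂ)^(-12:ℤ) = ((z:ℂ)^12)⁻¹ from by rw [_root_.zpow_neg]; rfl, inv_mul_cancel₀ (pow_ne_zero _ z.ne_zero), mul_one]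
  have QT : Q ∣[(k:ℤ) - 12 * m] ModularGroup.T = Q := by
    ext z
    rw [slash_T_aux]
    simp only [hQ, dT]
    rw [show (((1:ℝ) +ᵥ z : ℍ) : ℂ) = z + 1 by simp [add_comm], hT _ z.im_pos]
  have QS : Q ∣[(k:ℤ) - 12 * m] ModularGroup.S = Q := by
    ext z
    have h0 := z.ne_zero
    have hd := ModularForm.discriminant_ne_zero z
    rw [SlashInvariantForm.slash_S_apply, ← UpperHalfPlane.modular_S_smul]
    simp only [hQ, dS]
    have e : ((ModularGroup.S • z : ℍ) : ℂ) = -1 / z := by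
      rw [UpperHalfPlane.modular_S_smul]; simp [neg_div]
    rw [e, hS _ z.im_pos, neg_sub, zpow_sub₀ h0]
    have : (z:ℂ) ^ (12 * (m:ℤ)) = ((z:ℂ)^12)^m := by
      rw [← pow_mul]; exact_mod_cast rfl
    rw [this, zpow_natCast, mul_pow]
    field_simp
  have hinv := SlashInvariantForm.slash_action_generators_SL2Z QS QT
  have hbd : IsBoundedAtImInfty Q := by
    have h1 : (fun z : ℍ => P z) =O[atImInfty] fun z : ℍ => qExp z ^ m :=
      hO.comp_tendsto tendsto_coe_LInf
    have h2 : (fun z : ℍ => qExp z ^ m) =O[atImInfty] fun z => ModularForm.discriminant z ^ m := by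
      refine Asymptotics.IsBigO.pow ?_ m
      refine Asymptotics.IsBigO.trans (.of_bound 1 ?_) ModularForm.exp_isBigO_discriminant
      filter_upwards with z
      rw [norm_qExp]; simp
    exact (Asymptotics.div_isBoundedUnder_of_isBigO (h1.trans h2)).isBigO_one ℝ
  let M : ModularForm 𝒮ℒ ((k:ℤ) - 12 * m) :=
    { toFun := Q
      slash_action_eq' := fun _ ⟨γ, hγ⟩ ↦ hγ ▸ hinv γ
      holo' := by
        have hP' : MDifferentiable (modelWithCornersSelf ℂ ℂ) (modelWithCornersSelf ℂ ℂ)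
            (fun z : ℍ => P z) := by
          rw [UpperHalfPlane.mdifferentiable_iff]
          refine hP.congr fun z hz => ?_
          rw [Function.comp_apply, ofComplex_apply_of_im_pos hz]
        have hD : MDifferentiable (modelWithCornersSelf ℂ ℂ) (modelWithCornersSelf ℂ ℂ)
            (fun z : ℍ => ModularForm.discriminant z ^ m) := CuspForm.discriminant.holo'.pow m
        exact hP'.div hD fun z => pow_ne_zero _ (ModularForm.discriminant_ne_zero z)
      bdd_at_cusps' := by
        intro c hc
        rw [Subgroup.IsArithmetic.isCusp_iff_isCusp_SL2Z] at hc
        rw [OnePoint.isBoundedAt_iff_forall_SL2Z hc]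
        intro γ _
        rw [hinv γ]
        exact hbd }
  have h0 := ModularFormClass.levelOne_neg_weight_eq_zero (by omega : (k:ℤ) - 12 * m < 0) M
  have h1 : Q ⟨z, hz⟩ = 0 := congr_fun h0 ⟨z, hz⟩
  simp only [hQ, div_eq_zero_iff] at h1
  exact h1.resolve_right (pow_ne_zero _ (ModularForm.discriminant_ne_zero _))

lemma mul_zero_aux {f g : ℂ → ℂ} (hf : DifferentiableOn ℂ f {z | 0 < z.im})
    (hg : DifferentiableOn ℂ g {z | 0 < z.im}) (h : ∀ z : ℂ, 0 < z.im → f z * g z = 0) :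
    (∀ z : ℂ, 0 < z.im → f z = 0) ∨ (∀ z : ℂ, 0 < z.im → g z = 0) := by
  have ho : IsOpen {z : ℂ | 0 < z.im} := isOpen_lt continuous_const Complex.continuous_im
  have hc : IsPreconnected {z : ℂ | 0 < z.im} := (convex_halfSpace_im_gt 0).isPreconnected
  exact AnalyticOnNhd.eq_zero_or_eq_zero_of_mul_eq_zero (hf.analyticOnNhd ho) (hg.analyticOnNhd ho) h hc

/-- Vanishing criterion for forms of level `Γ₀(3)`. -/
lemma level_three_vanish {k : ℕ} (G H : ℂ → ℂ) (hk : Even k)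
    (hGd : DifferentiableOn ℂ G {z | 0 < z.im}) (hHd : DifferentiableOn ℂ H {z | 0 < z.im})
    (hGT : ∀ z : ℂ, G (z + 1) = G z)
    (hHT : ∀ z : ℂ, H (z + 3) = H z)
    (hGS : ∀ z : ℂ, 0 < z.im → G (-1 / z) = z ^ k * H z)
    (hGO : G =O[LInf] fun z => qExp z ^ 2)
    (hHO : H =O[LInf] fun z => qExp (z / 3)) (hkm : 4 * k < 12 * 3) (z : ℂ) (hz : 0 < z.im) :
    G z = 0 := by
  have ne : ∀ z : ℂ, 0 < z.im → z ≠ 0 := by rintro z hz rfl; simp at hz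
  have hHS : ∀ z : ℂ, 0 < z.im → H (-1 / z) = z ^ k * G z := by
    intro z hz
    have h0 := ne z hz
    have h := hGS (-1 / z) (im_neg_inv hz)
    rw [show -1 / (-1 / z) = z by field_simp, div_pow, hk.neg_one_pow] at h
    rw [h]; field_simp
  have key : ∀ z : ℂ, 0 < z.im → G (1 - 1 / z) = z ^ k * H z := by
    intro z hz
    rw [← hGS z hz, ← hGT (-1 / z)]; congr 1; ring
  have key' : ∀ z : ℂ, 0 < z.im → G (-1 - 1 / z) = z ^ k * H z := by
    intro z hz
    rw [← hGS z hz, ← hGT (-1 - 1 / z)]; congr 1; ring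
  have H1 : ∀ z : ℂ, 0 < z.im → H (-1 / z + 1) = z ^ k * H (z + 2) := by
    intro z hz
    have h0 := ne z hz
    have hz1 : 0 < (z - 1).im := by simpa using hz
    have h1 := ne _ hz1
    have hu : 0 < (-1 / z + 1).im := by simpa using im_neg_inv hz
    have hu0 := ne _ hu
    have h := hGS _ hu
    have e : -1 / (-1 / z + 1) = -1 - 1 / (z - 1) := by
      have : -1 / z + 1 = (z - 1) / z := by field_simp; ring
      rw [this]; field_simp; ring
    rw [e, key' _ hz1, show -1 / z + 1 = (z - 1) / z by field_simp; ring, div_pow] at h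
    rw [show -1 / z + 1 = (z - 1) / z by field_simp; ring]
    rw [← hHT (z - 1), show z - 1 + 3 = z + 2 by ring] at h
    have h2 : (z - 1) ^ k ≠ 0 := pow_ne_zero _ h1
    field_simp at h
    linear_combination (-1:ℂ) * h
  have H2 : ∀ z : ℂ, 0 < z.im → H (-1 / z + 2) = z ^ k * H (z + 1) := by
    intro z hz
    have h0 := ne z hz
    have hz1 : 0 < (z + 1).im := by simpa using hz
    have h1 := ne _ hz1
    have hu : 0 < (-1 / z - 1).im := by simpa using im_neg_inv hz
    have hu0 := ne _ hu
    have h := hGS _ hu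
    have e : -1 / (-1 / z - 1) = 1 - 1 / (z + 1) := by
      have : -1 / z - 1 = -(z + 1) / z := by field_simp; ring
      rw [this]; field_simp; ring
    rw [e, key _ hz1, show -1 / z - 1 = -((z + 1) / z) by field_simp; ring, hk.neg_pow, div_pow] at h
    rw [show -1 / z + 2 = -((z + 1) / z) + 3 by field_simp; ring, hHT]
    have h2 : (z + 1) ^ k ≠ 0 := pow_ne_zero _ h1
    field_simp at h
    linear_combination (-1:ℂ) * h
  have hHd1 : DifferentiableOn ℂ (fun z => H (z + 1)) {z | 0 < z.im} :=
    hHd.comp (by fun_prop) (fun z hz => by simpa using hz)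
  have hHd2 : DifferentiableOn ℂ (fun z => H (z + 2)) {z | 0 < z.im} :=
    hHd.comp (by fun_prop) (fun z hz => by simpa using hz)
  have qa : ∀ r : ℝ, (fun z => H (z + r)) =O[LInf] fun z => qExp (z / 3) := by
    intro r
    refine (hHO.comp_tendsto (tendsto_add_LInf r)).trans (.of_bound 1 ?_)
    filter_upwards with z
    simp [norm_qExp]
  have hPO : (fun z => (G z * H z) * (H (z + 1) * H (z + 2))) =O[LInf] fun z => qExp z ^ 3 := by
    have h1 := (hGO.mul hHO).mul ((qa 1).mul (qa 2))
    refine (h1.trans (.of_bound 1 ?_)).congr_left ?_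
    · filter_upwards with z
      have : qExp z = qExp (z / 3) ^ 3 := by rw [← qExp_mul]; congr 1; push_cast; ring
      rw [this, ← pow_mul]
      rw [one_mul]
      apply le_of_eq; congr 1; ring
    · intro z; simp
  have hP := levelOne_vanish (k := 4 * k) (m := 3) (fun z => (G z * H z) * (H (z + 1) * H (z + 2)))
    ((hGd.mul hHd).mul (hHd1.mul hHd2))
    (by intro z hz
        simp only [hGT]
        rw [show z + 1 + 1 = z + 2 by ring, show z + 1 + 2 = z + 3 by ring, hHT]; ring)
    (by intro z hz
        rw [hGS z hz, hHS z hz, H1 z hz, H2 z hz]; ring)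
    hPO hkm
  have hG0 : (∀ z : ℂ, 0 < z.im → H z = 0) → ∀ z : ℂ, 0 < z.im → G z = 0 := by
    intro h z hz
    have h0 := ne z hz
    have := hHS z hz
    rw [h _ (im_neg_inv hz)] at this
    simpa [h0] using this
  have sh : ∀ r : ℝ, (∀ z : ℂ, 0 < z.im → H (z + r) = 0) → ∀ z : ℂ, 0 < z.im → H z = 0 := by
    intro r h z hz
    have := h (z - r) (by simpa using hz)
    simpa using this
  rcases mul_zero_aux (hGd.mul hHd) (hHd1.mul hHd2) hP with h | h
  · rcases mul_zero_aux hGd hHd h with h | h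
    · exact h z hz
    · exact hG0 h z hz
  · rcases mul_zero_aux hHd1 hHd2 h with h | h
    · exact hG0 (sh 1 (by simpa using h)) z hz
    · exact hG0 (sh 2 (by simpa using h)) z hz

lemma E4_bdd1 : (fun z => (E4 z - 1) / qExp z) =O[LInf] (1 : ℂ → ℝ) := by
  have := coeff_bdd _ E4 (fun z hz => sum_aux 240 3 hz) 1
  simpa using this
lemma E4_bdd2 : (fun z => (E4 z - (1 + 240 * qExp z)) / qExp z ^ 2) =O[LInf] (1 : ℂ → ℝ) := by
  have := coeff_bdd _ E4 (fun z hz => sum_aux 240 3 hz) 2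
  simpa [Finset.sum_range_succ, sigma'] using this
lemma E6_eq (z : ℂ) : E6 z = 1 + (-504) * ∑' n : ℕ+, (sigma' 5 n : ℂ) * qExp z ^ (n : ℕ) := by
  unfold E6; ring
lemma E2_eq (z : ℂ) : E2 z = 1 + (-24) * ∑' n : ℕ+, (sigma' 1 n : ℂ) * qExp z ^ (n : ℕ) := by
  unfold E2; ring
lemma E6_bdd1 : (fun z => (E6 z - 1) / qExp z) =O[LInf] (1 : ℂ → ℝ) := by
  have := coeff_bdd _ E6 (fun z hz => E6_eq z ▸ sum_aux (-504) 5 hz) 1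
  simpa using this
lemma E6_bdd2 : (fun z => (E6 z - (1 + (-504) * qExp z)) / qExp z ^ 2) =O[LInf] (1 : ℂ → ℝ) := by
  have := coeff_bdd _ E6 (fun z hz => E6_eq z ▸ sum_aux (-504) 5 hz) 2
  simpa [Finset.sum_range_succ, sigma'] using this
lemma E2_bdd1 : (fun z => (E2 z - 1) / qExp z) =O[LInf] (1 : ℂ → ℝ) := by
  have := coeff_bdd _ E2 (fun z hz => E2_eq z ▸ sum_aux (-24) 1 hz) 1
  simpa using this
lemma E2_bdd2 : (fun z => (E2 z - (1 + (-24) * qExp z)) / qExp z ^ 2) =O[LInf] (1 : ℂ → ℝ) := by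
  have := coeff_bdd _ E2 (fun z hz => E2_eq z ▸ sum_aux (-24) 1 hz) 2
  simpa [Finset.sum_range_succ, sigma'] using this

/-- Boundedness at `i∞`. -/
def Bdd (f : ℂ → ℂ) : Prop := f =O[LInf] (1 : ℂ → ℝ)

lemma Bdd.add {f g : ℂ → ℂ} (hf : Bdd f) (hg : Bdd g) : Bdd (fun z => f z + g z) :=
  Asymptotics.IsBigO.add hf hg
lemma Bdd.sub {f g : ℂ → ℂ} (hf : Bdd f) (hg : Bdd g) : Bdd (fun z => f z - g z) :=
  Asymptotics.IsBigO.sub hf hg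
lemma Bdd.mul {f g : ℂ → ℂ} (hf : Bdd f) (hg : Bdd g) : Bdd (fun z => f z * g z) :=
  (Asymptotics.IsBigO.mul hf hg).congr_right (by intro z; simp)
lemma Bdd.const (c : ℂ) : Bdd (fun _ => c) := Asymptotics.isBigO_const_const c one_ne_zero _
lemma Bdd.pow {f : ℂ → ℂ} (hf : Bdd f) (n : ℕ) : Bdd (fun z => f z ^ n) :=
  (Asymptotics.IsBigO.pow hf n).congr_right (by intro z; simp)

/-- An expansion `f = a + b q + r q²` with bounded remainder. -/
lemma exp2 {f : ℂ → ℂ} {b : ℂ}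
    (h : (fun z => (f z - (1 + b * qExp z)) / qExp z ^ 2) =O[LInf] (1 : ℂ → ℝ)) :
    ∃ r : ℂ → ℂ, Bdd r ∧ ∀ z, f z = 1 + b * qExp z + qExp z ^ 2 * r z :=
  ⟨_, h, fun z => by have := qExp_ne z; field_simp; ring⟩

lemma exp1 {f : ℂ → ℂ}
    (h : (fun z => (f z - 1) / qExp z) =O[LInf] (1 : ℂ → ℝ)) :
    ∃ r : ℂ → ℂ, Bdd r ∧ ∀ z, f z = 1 + qExp z * r z :=
  ⟨_, h, fun z => by have := qExp_ne z; field_simp; ring⟩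

lemma Bdd.three {f : ℂ → ℂ} (hf : Bdd f) : Bdd (fun z => f (3 * z)) := by
  have := Asymptotics.IsBigO.comp_tendsto hf (tendsto_mul_LInf (r := 3) (by norm_num))
  refine (this.congr_left fun z => ?_)
  simp only [Function.comp_apply]; congr 1
lemma Bdd.third {f : ℂ → ℂ} (hf : Bdd f) : Bdd (fun z => f (z / 3)) := by
  have := Asymptotics.IsBigO.comp_tendsto hf (tendsto_mul_LInf (r := 1 / 3) (by norm_num))
  refine (this.congr_left fun z => ?_)
  simp only [Function.comp_apply]; congr 1; push_cast; ring

lemma q3 (z : ℂ) : qExp (3 * z) = qExp z ^ 3 := by rw [← qExp_mul]; norm_num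
lemma q3' (z : ℂ) : qExp z = qExp (z / 3) ^ 3 := by rw [← q3]; congr 1; ring

lemma bigO_of_eq {f g r : ℂ → ℂ} (hr : Bdd r) (h : ∀ z, f z = g z * r z) : f =O[LInf] g := by
  have h2 : f =O[LInf] fun z => ‖g z‖ * (1:ℝ) := by
    refine Asymptotics.IsBigO.congr_left (f₁ := fun z => g z * r z) ?_ (fun z => (h z).symm)
    refine ((Asymptotics.isBigO_refl g LInf).norm_right).mul hr
  simpa using h2

/-- `F = (3 E₂(3z) - E₂(z)) / 2`. -/
noncomputable def FF (z : ℂ) : ℂ := (3 * E2 (3 * z) - E2 z) / 2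
/-- The transform of `FF` at the other cusp. -/
noncomputable def KK (z : ℂ) : ℂ := (E2 (z / 3) / 3 - E2 z) / 2

lemma im3 {z : ℂ} (hz : 0 < z.im) : 0 < (3 * z).im := by simpa using hz
lemma im3' {z : ℂ} (hz : 0 < z.im) : 0 < (z / 3).im := by
  rw [show z / 3 = ((1/3:ℝ):ℂ) * z by push_cast; ring, Complex.im_ofReal_mul]; positivity

lemma diff3 {f : ℂ → ℂ} (hf : DifferentiableOn ℂ f {z | 0 < z.im}) :
    DifferentiableOn ℂ (fun z => f (3 * z)) {z | 0 < z.im} :=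
  hf.comp (by fun_prop) (fun _ hz => im3 hz)
lemma diff3' {f : ℂ → ℂ} (hf : DifferentiableOn ℂ f {z | 0 < z.im}) :
    DifferentiableOn ℂ (fun z => f (z / 3)) {z | 0 < z.im} :=
  hf.comp (by fun_prop) (fun _ hz => im3' hz)

lemma per3 {f : ℂ → ℂ} (hf : ∀ z, f (z + 1) = f z) (z : ℂ) : f (z + 3) = f z := by
  rw [show z + 3 = z + 1 + 1 + 1 by ring, hf, hf, hf]
lemma per3a {f : ℂ → ℂ} (hf : ∀ z, f (z + 1) = f z) (z : ℂ) : f (3 * (z + 1)) = f (3 * z) := by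
  rw [mul_add, mul_one, per3 hf]
lemma per3b {f : ℂ → ℂ} (hf : ∀ z, f (z + 1) = f z) (z : ℂ) : f ((z + 3) / 3) = f (z / 3) := by
  rw [show (z + 3) / 3 = z / 3 + 1 by ring, hf]

lemma FF_diff : DifferentiableOn ℂ FF {z | 0 < z.im} :=
  (((diff3 E2_diff).const_mul 3).sub E2_diff).div_const 2
lemma KK_diff : DifferentiableOn ℂ KK {z | 0 < z.im} :=
  (((diff3' E2_diff).div_const 3).sub E2_diff).div_const 2
lemma FF_T (z : ℂ) : FF (z + 1) = FF z := by
  simp only [FF, per3a E2_add_one, E2_add_one]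
lemma KK_T (z : ℂ) : KK (z + 3) = KK z := by
  simp only [KK, per3b E2_add_one, per3 E2_add_one]
lemma s3 (z : ℂ) : 3 * (-1 / z) = -1 / (z / 3) := by
  by_cases h : z = 0
  · simp [h]
  · field_simp
lemma FF_S {z : ℂ} (hz : 0 < z.im) : FF (-1 / z) = z ^ 2 * KK z := by
  simp only [FF, KK, s3, E2_S hz, E2_S (im3' hz)]; ring

lemma FF_exp : ∃ r : ℂ → ℂ, Bdd r ∧ ∀ z, FF z = 1 + 12 * qExp z + qExp z ^ 2 * r z := by
  obtain ⟨r, hr, h⟩ := exp2 E2_bdd2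
  refine ⟨fun z => (-36) * qExp z + (3 / 2) * (qExp z ^ 4 * r (3 * z)) - (1 / 2) * r z, ?_, ?_⟩
  · exact (((Bdd.const _).mul qExp_bdd).add
      ((Bdd.const _).mul ((Bdd.pow qExp_bdd 4).mul hr.three))).sub ((Bdd.const _).mul hr)
  · intro z; rw [FF, h, h, q3]; ring

lemma KK_exp : ∃ r : ℂ → ℂ, Bdd r ∧ ∀ z, KK z = -1 / 3 + qExp (z / 3) * r z := by
  obtain ⟨r, hr, h⟩ := exp1 E2_bdd1
  refine ⟨fun z => (1 / 6) * r (z / 3) - (1 / 2) * (qExp (z / 3) ^ 2 * r z), ?_, ?_⟩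
  · exact ((Bdd.const _).mul hr.third).sub
      ((Bdd.const _).mul ((Bdd.pow (Bdd.third qExp_bdd) 2).mul hr))
  · intro z; rw [KK, h, h, q3' z]; ring

lemma identity_four {z : ℂ} (hz : 0 < z.im) : E4 z + 9 * E4 (3 * z) - 10 * FF z ^ 2 = 0 := by
  refine level_three_vanish (k := 4) (fun z => E4 z + 9 * E4 (3 * z) - 10 * FF z ^ 2)
    (fun z => E4 z + (1 / 9) * E4 (z / 3) - 10 * KK z ^ 2) ⟨2, rfl⟩
    ((E4_diff.add ((diff3 E4_diff).const_mul 9)).sub ((FF_diff.pow 2).const_mul 10))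
    ((E4_diff.add ((diff3' E4_diff).const_mul _)).sub ((KK_diff.pow 2).const_mul 10))
    ?_ ?_ ?_ ?_ ?_ (by norm_num) z hz
  · intro z; simp only [per3a E4_add_one, E4_add_one, FF_T]
  · intro z; simp only [per3b E4_add_one, per3 E4_add_one, KK_T]
  · intro z hz; simp only [s3, E4_S hz, E4_S (im3' hz), FF_S hz]; ring
  · obtain ⟨r, hr, h⟩ := exp2 E4_bdd2
    obtain ⟨s, hs, h'⟩ := FF_exp
    refine bigO_of_eq (r := fun z => r z + 2160 * qExp z + 9 * (qExp z ^ 4 * r (3 * z))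
        - 10 * (144 + qExp z ^ 2 * s z ^ 2 + 2 * s z + 24 * (qExp z * s z))) ?_ ?_
    · have q := qExp_bdd
      exact ((hr.add ((Bdd.const _).mul q)).add ((Bdd.const _).mul ((Bdd.pow q 4).mul hr.three))).sub
        ((Bdd.const _).mul ((((Bdd.const _).add ((Bdd.pow q 2).mul (hs.pow 2))).add
        ((Bdd.const _).mul hs)).add ((Bdd.const _).mul (Bdd.mul q hs))))
    · intro z; simp only [h, h', q3]; ring
  · obtain ⟨r, hr, h⟩ := exp1 E4_bdd1
    obtain ⟨s, hs, h'⟩ := KK_exp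
    refine bigO_of_eq (r := fun z => qExp (z / 3) ^ 2 * r z + (1 / 9) * r (z / 3)
      - 10 * ((-2 / 3) * s z + qExp (z / 3) * s z ^ 2)) ?_ ?_
    · have q : Bdd (fun z => qExp (z / 3)) := Bdd.third qExp_bdd
      exact (((q.pow 2).mul hr).add ((Bdd.const _).mul hr.third)).sub ((Bdd.const _).mul
        (((Bdd.const _).mul hs).add (q.mul (hs.pow 2))))
    · intro z; simp only [h, h']; rw [q3' z]; ring

lemma identity_six {z : ℂ} (hz : 0 < z.im) :
    E6 z + 27 * E6 (3 * z) - (35 * FF z ^ 3 - 7 * (FF z * E4 z)) = 0 := by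
  refine level_three_vanish (k := 6)
    (fun z => E6 z + 27 * E6 (3 * z) - (35 * FF z ^ 3 - 7 * (FF z * E4 z)))
    (fun z => E6 z + (1 / 27) * E6 (z / 3) - (35 * KK z ^ 3 - 7 * (KK z * E4 z))) ⟨3, rfl⟩
    ((E6_diff.add ((diff3 E6_diff).const_mul _)).sub
      (((FF_diff.pow 3).const_mul _).sub ((FF_diff.mul E4_diff).const_mul _)))
    ((E6_diff.add ((diff3' E6_diff).const_mul _)).sub
      (((KK_diff.pow 3).const_mul _).sub ((KK_diff.mul E4_diff).const_mul _)))
    ?_ ?_ ?_ ?_ ?_ (by norm_num) z hz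
  · intro z; simp only [per3a E6_add_one, E4_add_one, E6_add_one, FF_T]
  · intro z; simp only [per3b E6_add_one, per3 E6_add_one, per3 E4_add_one, KK_T]
  · intro z hz; simp only [s3, E4_S hz, E6_S hz, E6_S (im3' hz), FF_S hz]; ring
  · obtain ⟨r, hr, h⟩ := exp2 E4_bdd2
    obtain ⟨s, hs, h'⟩ := FF_exp
    obtain ⟨t, ht, h''⟩ := exp2 E6_bdd2
    refine bigO_of_eq (r := fun z => t z + 27 * ((-504) * qExp z + qExp z ^ 4 * t (3 * z))
        - (35 * (3 * s z + 3 * (12 + qExp z * s z) ^ 2 + qExp z * (12 + qExp z * s z) ^ 3)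
          - 7 * (s z + r z + (12 + qExp z * s z) * (240 + qExp z * r z)))) ?_ ?_
    · have q : Bdd qExp := qExp_bdd
      have hv : Bdd (fun z => 12 + qExp z * s z) := (Bdd.const _).add (q.mul hs)
      exact (ht.add ((Bdd.const _).mul (((Bdd.const _).mul q).add ((q.pow 4).mul ht.three)))).sub
        (((Bdd.const _).mul ((((Bdd.const _).mul hs).add ((Bdd.const _).mul (hv.pow 2))).add
          (q.mul (hv.pow 3)))).sub
        ((Bdd.const _).mul ((hs.add hr).add (hv.mul ((Bdd.const _).add (q.mul hr))))))
    · intro z; simp only [h, h', h'', q3]; ring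
  · obtain ⟨r, hr, h⟩ := exp1 E4_bdd1
    obtain ⟨s, hs, h'⟩ := KK_exp
    obtain ⟨t, ht, h''⟩ := exp1 E6_bdd1
    have q : Bdd (fun z => qExp (z / 3)) := Bdd.third qExp_bdd
    refine bigO_of_eq (r := fun z => qExp (z / 3) ^ 2 * t z + (1 / 27) * t (z / 3)
      - (35 * ((1 / 3) * s z - qExp (z / 3) * s z ^ 2 + qExp (z / 3) ^ 2 * s z ^ 3)
         - 7 * (s z + ((-1 / 3) + qExp (z / 3) * s z) * (qExp (z / 3) ^ 2 * r z)))) ?_ ?_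
    · exact (((q.pow 2).mul ht).add ((Bdd.const _).mul ht.third)).sub (((Bdd.const _).mul
        ((((Bdd.const _).mul hs).sub (q.mul (hs.pow 2))).add ((q.pow 2).mul (hs.pow 3)))).sub
        ((Bdd.const _).mul (hs.add (((Bdd.const _).add (q.mul hs)).mul ((q.pow 2).mul hr)))))
    · intro z; simp only [h, h', h'']; rw [q3' z]; ring

/-- At the Heegner point `τ = (−11 + i√11)/22` of discriminant `−11`, the invariants
`a₄, a₆, a₄′, a₆′` take the stated rational values. -/
theorem a4_a6_at_heegner_11 :
    E2N 11 ((-11 + Complex.I * (Real.sqrt 11 : ℂ)) / 22) ≠ 0 ∧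
    a4 11 ((-11 + Complex.I * (Real.sqrt 11 : ℂ)) / 22) = -33 / 2 ∧
    a6 11 ((-11 + Complex.I * (Real.sqrt 11 : ℂ)) / 22) = -847 / 32 ∧
    a4' 11 ((-11 + Complex.I * (Real.sqrt 11 : ℂ)) / 22) = -3 / 22 ∧
    a6' 11 ((-11 + Complex.I * (Real.sqrt 11 : ℂ)) / 22) = 7 / 352 := by
  obtain ⟨s, hs⟩ : ∃ s : ℂ, s = Complex.I * (Real.sqrt 11 : ℂ) := ⟨_, rfl⟩
  rw [← hs]
  have s2 : s ^ 2 = -11 := by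
    rw [hs, mul_pow, Complex.I_sq, ← Complex.ofReal_pow, Real.sq_sqrt (by norm_num)]; norm_num
  have sim : 0 < s.im := by
    rw [hs]; simp
  have shift : ∀ a b : ℝ, 0 < b → 0 < ((a : ℂ) + (b : ℂ) * s).im := by
    intro a b hb
    rw [Complex.add_im, Complex.ofReal_im, Complex.im_ofReal_mul, zero_add]; positivity
  obtain ⟨w, hw⟩ : ∃ w : ℂ, w = (1 + s) / 2 := ⟨_, rfl⟩
  obtain ⟨u, hu⟩ : ∃ u : ℂ, u = (-1 + s) / 6 := ⟨_, rfl⟩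
  obtain ⟨τ, hτ⟩ : ∃ τ : ℂ, τ = (-11 + s) / 22 := ⟨_, rfl⟩
  rw [← hτ]
  have wim : 0 < w.im := by
    rw [hw]; convert shift (1/2) (1/2) (by norm_num) using 2; push_cast; ring
  have uim : 0 < u.im := by
    rw [hu]; convert shift (-1/6) (1/6) (by norm_num) using 2; push_cast; ring
  have τim : 0 < τ.im := by
    rw [hτ]; convert shift (-11/22) (1/22) (by norm_num) using 2; push_cast; ring
  have ne : ∀ z : ℂ, 0 < z.im → z ≠ 0 := by rintro z hz rfl; simp at hz
  have w2 : w ^ 2 = w - 3 := by rw [hw]; linear_combination s2 / 4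
  have ws : s = 2 * w - 1 := by rw [hw]; ring
  -- relations between the points
  have e1 : -1 / τ = u + 1 + 1 := by
    rw [div_eq_iff (ne _ τim), hτ, hu]; linear_combination (-1/132) * s2
  have e2 : -1 / u = w := by
    rw [div_eq_iff (ne _ uim), hw, hu]; linear_combination (-1/12) * s2
  have e3 : -1 / (w / 3) = w - 1 := by
    rw [div_eq_iff (ne _ (im3' wim))]; linear_combination (-1/3) * w2
  have e4 : 11 * τ + 1 + 1 + 1 + 1 + 1 + 1 = w := by rw [hτ, hw]; ring
  have per : ∀ f : ℂ → ℂ, (∀ z, f (z + 1) = f z) → f (11 * τ) = f w := by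
    intro f hf
    rw [← e4]; simp only [hf]
  have per' : ∀ f : ℂ → ℂ, (∀ z, f (z + 1) = f z) → f (w - 1) = f w := by
    intro f hf
    rw [← hf (w - 1), sub_add_cancel]
  have uτ : u * τ = -s / 11 := by rw [hu, hτ]; linear_combination (1/132) * s2
  -- from `τ` to `w`
  have t4 : E4 τ = 121 * E4 w := by
    have h1 := E4_S τim
    have h2 := E4_S uim
    rw [e1, E4_add_one, E4_add_one] at h1
    rw [e2, h1] at h2
    have : (u * τ) ^ 4 = 1 / 121 := by
      rw [uτ]; linear_combination (1 / 14641) * (s ^ 2 - 11) * s2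
    linear_combination (-121) * h2 - 121 * E4 τ * this
  have t6 : E6 τ = -1331 * E6 w := by
    have h1 := E6_S τim
    have h2 := E6_S uim
    rw [e1, E6_add_one, E6_add_one] at h1
    rw [e2, h1] at h2
    have : (u * τ) ^ 6 = -1 / 1331 := by
      rw [uτ]; linear_combination (1 / 1771561) * (s ^ 4 - 11 * s ^ 2 + 121) * s2
    linear_combination (1331) * h2 + 1331 * E6 τ * this
  obtain ⟨c, hc⟩ : ∃ c : ℂ, c = 6 / (Real.pi * Complex.I) := ⟨_, rfl⟩
  obtain ⟨Y, hY⟩ : ∃ Y : ℂ, Y = E2 w - s * c / 11 := ⟨_, rfl⟩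
  have t2 : E2N 11 τ = 11 / 12 * Y := by
    have h1 := E2_S τim
    have h2 := E2_S uim
    rw [e1, E2_add_one, E2_add_one, ← hc] at h1
    rw [e2, h1, ← hc] at h2
    have h3 : (u * τ) ^ 2 = -1 / 11 := by
      rw [uτ]; linear_combination (1 / 121) * s2
    have h4 : u * (1 + u * τ) * 11 = 2 * s := by
      rw [uτ, hu]; linear_combination (-1/6) * s2
    rw [E2N_eq τim, per E2 E2_add_one, hY]
    linear_combination (-11 / 24) * h2 - (11 / 24) * E2 τ * h3 - c / 24 * h4
  -- level three
  have v4 : E4 (w / 3) = (1 - w) ^ 4 * E4 w := by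
    have h1 := E4_S (im3' wim)
    rw [e3, per' E4 E4_add_one] at h1
    have : ((1 - w) * (w / 3)) = 1 := by linear_combination (-1/3) * w2
    rw [h1, ← mul_assoc, ← mul_pow, this, one_pow, one_mul]
  have v6 : E6 (w / 3) = (1 - w) ^ 6 * E6 w := by
    have h1 := E6_S (im3' wim)
    rw [e3, per' E6 E6_add_one] at h1
    have : ((1 - w) * (w / 3)) = 1 := by linear_combination (-1/3) * w2
    rw [h1, ← mul_assoc, ← mul_pow, this, one_pow, one_mul]
  have v2 : E2 (w / 3) = (1 - w) ^ 2 * (E2 w - c * (w / 3)) := by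
    have h1 := E2_S (im3' wim)
    rw [e3, per' E2 E2_add_one, ← hc] at h1
    have : ((1 - w) * (w / 3)) = 1 := by linear_combination (-1/3) * w2
    rw [h1, add_sub_cancel_right, ← mul_assoc, ← mul_pow, this, one_pow, one_mul]
  have w3 : 3 * (w / 3) = w := by ring
  have p2 : (1 - w) ^ 2 = -2 - w := by linear_combination w2
  have p4 : (1 - w) ^ 4 = 1 + 5 * w := by
    rw [show (1 - w) ^ 4 = ((1 - w) ^ 2) ^ 2 by ring, p2]; linear_combination w2
  have p6 : (1 - w) ^ 6 = 13 - 16 * w := by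
    rw [show (1 - w) ^ 6 = (1 - w) ^ 2 * (1 - w) ^ 4 by ring, p2, p4]
    linear_combination (-5) * w2
  have hF : FF (w / 3) = (5 + w) / 2 * Y := by
    rw [FF, w3, v2, p2, hY, ws]
    linear_combination (- c / 6 + c / 11) * w2
  have i4 := identity_four (im3' wim)
  have i6 := identity_six (im3' wim)
  rw [w3, v4, hF, p4] at i4
  rw [w3, v6, v4, hF, p4, p6] at i6
  have n1 : (2 + w) ≠ 0 := by
    intro h; have : (2 + w) * (3 - w) = 9 := by linear_combination -w2
    rw [h] at this; norm_num at this
  have n2 : (5 - 2 * w) ≠ 0 := by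
    intro h; have : (5 - 2 * w) * (3 + 2 * w) = 27 := by linear_combination (-4) * w2
    rw [h] at this; norm_num at this
  have r4 : E4 w = 11 / 2 * Y ^ 2 := by
    apply mul_left_cancel₀ n1
    linear_combination (1 / 5) * i4 + (1 / 2) * Y ^ 2 * w2
  have r6 : E6 w = 847 / 64 * Y ^ 3 := by
    apply mul_left_cancel₀ n2
    rw [r4] at i6
    linear_combination (1 / 8) * i6 + (35 / 64) * (w - 6) * Y ^ 3 * w2
  have hY0 : Y ≠ 0 := by
    rintro rfl
    exact disc_ne wim (by rw [r4]; simp) (by rw [r6]; simp)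
  refine ⟨?_, ?_, ?_, ?_, ?_⟩
  · rw [t2]; exact mul_ne_zero (by norm_num) hY0
  · rw [a4, t2, t4, r4]; field_simp; norm_num
  · rw [a6, t2, t6, r6]; field_simp; norm_num
  · rw [a4', t2, Nat.cast_ofNat, per E4 E4_add_one, r4]; field_simp; norm_num
  · rw [a6', t2, Nat.cast_ofNat, per E6 E6_add_one, r6]; field_simp; norm_num
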